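/- arXiv:1305.0729 — 2 statements merged into one kernel-verified Lean document; each statement's English description precedes it below -/
import Mathlib

section
/- Let F ∈ M_n(ℤ) be symmetric and consider the graph X whose vertex set is {x ∈ ℤⁿ : xᵗFx = −2}, with u, w adjacent when u ≠ w and uᵗFw = −3. Fix a vertex u and let G_u be the subgroup of GL_n(ℚ) generated by the reflections r_{u−w}, where w ranges over the vertices adjacent to u (for such w one has (u−w, u−w) = 2, so r_{u−w} is defined, integral, and preserves F). Then: (a) every g ∈ G_u maps the connected component of u in X into itself; (b) G_u acts transitively on this component, i.e. for every vertex z reachable from u in X there exists g ∈ G_u with g·u = z. -/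
open Matrix

/-- Cast an integer vector to a rational vector. -/
def qv {n : ℕ} (u : Fin n → ℤ) : Fin n → ℚ := fun i => (u i : ℚ)

/-- Cast an integer matrix to a rational matrix. -/
def qm {n : ℕ} (F : Matrix (Fin n) (Fin n) ℤ) : Matrix (Fin n) (Fin n) ℚ :=
  F.map (fun x => (x : ℚ))

/-- The matrix of the reflection `r_v : y ↦ y - (2 (v,y)/(v,v)) v` in the root `v`,
with respect to the bilinear form `(x,y) = xᵗ F y`. -/
def reflMat {n : ℕ} (F : Matrix (Fin n) (Fin n) ℚ) (v : Fin n → ℚ) :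
    Matrix (Fin n) (Fin n) ℚ :=
  1 - (2 / (v ⬝ᵥ F.mulVec v)) • vecMulVec v (Fᵀ.mulVec v)

/-- Adjacency in the minimal distance graph of `F`: both vectors are `(-2)`-roots,
they are distinct and their inner product is `-3`. -/
def Adj {n : ℕ} (F : Matrix (Fin n) (Fin n) ℤ) (x y : Fin n → ℤ) : Prop :=
  x ⬝ᵥ F.mulVec x = -2 ∧ y ⬝ᵥ F.mulVec y = -2 ∧ x ≠ y ∧ x ⬝ᵥ F.mulVec y = -3

/-- The subgroup `G_u` of `GL_n(ℚ)` generated by the reflections `r_{u-w}` for `w`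
adjacent to `u` in the minimal distance graph. -/
def Gu {n : ℕ} (F : Matrix (Fin n) (Fin n) ℤ) (u : Fin n → ℤ) :
    Subgroup (Matrix (Fin n) (Fin n) ℚ)ˣ :=
  Subgroup.closure
    {g | ∃ w : Fin n → ℤ, Adj F u w ∧
      (g : Matrix (Fin n) (Fin n) ℚ) = reflMat (qm F) (qv (u - w))}

lemma form_symm {n : ℕ} {F : Matrix (Fin n) (Fin n) ℤ} (hF : F.IsSymm) (x y : Fin n → ℤ) :
    x ⬝ᵥ F.mulVec y = y ⬝ᵥ F.mulVec x := by
  rw [dotProduct_mulVec, ← mulVec_transpose, hF.eq, dotProduct_comm]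

/-- integral reflection -/
def zrefl {n : ℕ} (F : Matrix (Fin n) (Fin n) ℤ) (v y : Fin n → ℤ) : Fin n → ℤ :=
  y - (v ⬝ᵥ F.mulVec y) • v

lemma zrefl_form {n : ℕ} {F : Matrix (Fin n) (Fin n) ℤ} (hF : F.IsSymm) (v : Fin n → ℤ)
    (hv : v ⬝ᵥ F.mulVec v = 2) (x y : Fin n → ℤ) :
    zrefl F v x ⬝ᵥ F.mulVec (zrefl F v y) = x ⬝ᵥ F.mulVec y := by
  simp only [zrefl, mulVec_sub, mulVec_smul, dotProduct_sub, sub_dotProduct, dotProduct_smul,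
    smul_dotProduct, smul_eq_mul, hv, form_symm hF x v]
  ring

lemma zrefl_invol {n : ℕ} {F : Matrix (Fin n) (Fin n) ℤ} (v : Fin n → ℤ)
    (hv : v ⬝ᵥ F.mulVec v = 2) (y : Fin n → ℤ) :
    zrefl F v (zrefl F v y) = y := by
  simp only [zrefl, mulVec_sub, mulVec_smul, dotProduct_sub, dotProduct_smul, smul_eq_mul, hv]
  ext i
  simp only [Pi.sub_apply, Pi.smul_apply, smul_eq_mul]
  ring

lemma qform {n : ℕ} (F : Matrix (Fin n) (Fin n) ℤ) (x y : Fin n → ℤ) :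
    qv x ⬝ᵥ (qm F).mulVec (qv y) = ((x ⬝ᵥ F.mulVec y : ℤ) : ℚ) := by
  simp [qv, qm, dotProduct, mulVec]

lemma reflMat_mulVec {n : ℕ} {F : Matrix (Fin n) (Fin n) ℤ} (v : Fin n → ℤ)
    (hv : v ⬝ᵥ F.mulVec v = 2) (y : Fin n → ℤ) :
    (reflMat (qm F) (qv v)).mulVec (qv y) = qv (zrefl F v y) := by
  have h : (qm F)ᵀ.mulVec (qv v) ⬝ᵥ qv y = ((v ⬝ᵥ F.mulVec y : ℤ) : ℚ) := by
    rw [← qform, mulVec_transpose, dotProduct_mulVec]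
  rw [reflMat, qform, hv, sub_mulVec, one_mulVec, smul_mulVec, vecMulVec_mulVec, h]
  ext i
  simp [qv, zrefl]
  ring

lemma adj_v {n : ℕ} {F : Matrix (Fin n) (Fin n) ℤ} (hF : F.IsSymm) {u w : Fin n → ℤ}
    (h : Adj F u w) : (u - w) ⬝ᵥ F.mulVec (u - w) = 2 ∧ zrefl F (u - w) u = w := by
  obtain ⟨h1, h2, -, h3⟩ := h
  have h4 := form_symm hF w u
  rw [h3] at h4
  constructor
  · simp only [mulVec_sub, dotProduct_sub, sub_dotProduct, h1, h2, h3, h4]; norm_num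
  · simp only [zrefl, sub_dotProduct, h1, h4]; norm_num

/-- good elements -/
def Good {n : ℕ} (F : Matrix (Fin n) (Fin n) ℤ) (u : Fin n → ℤ)
    (A : Matrix (Fin n) (Fin n) ℚ) : Prop :=
  ∃ φ : (Fin n → ℤ) → (Fin n → ℤ), (∀ y, A.mulVec (qv y) = qv (φ y)) ∧
    (∀ x y, φ x ⬝ᵥ F.mulVec (φ y) = x ⬝ᵥ F.mulVec y) ∧ Relation.ReflTransGen (Adj F) u (φ u)

lemma adj_map {n : ℕ} {F : Matrix (Fin n) (Fin n) ℤ} {φ : (Fin n → ℤ) → (Fin n → ℤ)}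
    (h : ∀ x y, φ x ⬝ᵥ F.mulVec (φ y) = x ⬝ᵥ F.mulVec y) (x y : Fin n → ℤ)
    (hxy : Adj F x y) : Adj F (φ x) (φ y) := by
  obtain ⟨h1, h2, -, h3⟩ := hxy
  refine ⟨by rw [h, h1], by rw [h, h2], fun he => ?_, by rw [h, h3]⟩
  have := h x y
  rw [← he, h, h1, h3] at this
  norm_num at this

lemma good_of_mem {n : ℕ} {F : Matrix (Fin n) (Fin n) ℤ} (hF : F.IsSymm) (u : Fin n → ℤ)
    (g : (Matrix (Fin n) (Fin n) ℚ)ˣ) (hg : g ∈ Gu F u) :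
    Good F u (g : Matrix (Fin n) (Fin n) ℚ) ∧
      Good F u ((g⁻¹ : (Matrix (Fin n) (Fin n) ℚ)ˣ) : Matrix (Fin n) (Fin n) ℚ) := by
  have hmul : ∀ A B : Matrix (Fin n) (Fin n) ℚ, Good F u A → Good F u B → Good F u (A * B) := by
    rintro A B ⟨φ, h1, h2, h3⟩ ⟨ψ, k1, k2, k3⟩
    refine ⟨φ ∘ ψ, fun y => ?_, fun x y => ?_, ?_⟩
    · rw [← mulVec_mulVec, k1, h1]; rfl
    · simp only [Function.comp, h2, k2]
    · exact h3.trans (k3.lift φ (adj_map h2))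
  induction hg using Subgroup.closure_induction with
  | mem g hg =>
    obtain ⟨w, hw, hgw⟩ := hg
    obtain ⟨hv, huw⟩ := adj_v hF hw
    have hr : Relation.ReflTransGen (Adj F) u (zrefl F (u - w) u) := by
      rw [huw]; exact .single hw
    have hy : ∀ y, (g : Matrix (Fin n) (Fin n) ℚ).mulVec (qv y) = qv (zrefl F (u - w) y) := by
      intro y; rw [hgw, reflMat_mulVec _ hv]
    refine ⟨⟨_, hy, zrefl_form hF _ hv, hr⟩, ⟨_, fun y => ?_, zrefl_form hF _ hv, hr⟩⟩
    conv_lhs => rw [← zrefl_invol _ hv y, ← hy, mulVec_mulVec, Units.inv_mul, one_mulVec]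
  | one =>
    have : Good F u 1 := ⟨id, fun y => by simp, fun x y => rfl, .refl⟩
    simpa using this
  | mul x y hx hy ihx ihy =>
    rw [_root_.mul_inv_rev, Units.val_mul, Units.val_mul]
    exact ⟨hmul _ _ ihx.1 ihy.1, hmul _ _ ihy.2 ihx.2⟩
  | inv x hx ih => rw [inv_inv]; exact ⟨ih.2, ih.1⟩

theorem stmt5 (n : ℕ) (F : Matrix (Fin n) (Fin n) ℤ) (hF : F.IsSymm)
    (u : Fin n → ℤ) (hu : u ⬝ᵥ F.mulVec u = -2) :
    (∀ g ∈ Gu F u, ∀ z : Fin n → ℤ, Relation.ReflTransGen (Adj F) u z →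
      ∃ z' : Fin n → ℤ, Relation.ReflTransGen (Adj F) u z' ∧
        (g : Matrix (Fin n) (Fin n) ℚ).mulVec (qv z) = qv z') ∧
    (∀ z : Fin n → ℤ, Relation.ReflTransGen (Adj F) u z →
      ∃ g ∈ Gu F u, (g : Matrix (Fin n) (Fin n) ℚ).mulVec (qv u) = qv z) := by
  constructor
  · intro g hg z hz
    obtain ⟨φ, h1, h2, h3⟩ := (good_of_mem hF u g hg).1
    exact ⟨φ z, h3.trans (hz.lift φ (adj_map h2)), h1 z⟩
  · intro z hz
    induction hz with
    | refl => exact ⟨1, one_mem _, by simp⟩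
    | @tail b c hb hbc ih =>
      obtain ⟨g, hg, hgu⟩ := ih
      obtain ⟨φ, h1, h2, -⟩ := (good_of_mem hF u g hg).2
      have hub : φ b = u := by
        have h := h1 b
        rw [← hgu, mulVec_mulVec, Units.inv_mul, one_mulVec] at h
        ext i
        have := congrFun h i
        simp only [qv] at this
        exact_mod_cast this.symm
      have hadj := adj_map h2 b c hbc
      rw [hub] at hadj
      obtain ⟨hv, huw⟩ := adj_v hF hadj
      have hsq : reflMat (qm F) (qv (u - φ c)) * reflMat (qm F) (qv (u - φ c)) = 1 := by
        apply Matrix.ext_of_mulVec_single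
        intro i
        have hi : (Pi.single i 1 : Fin n → ℚ) = qv (Pi.single i 1) := by
          ext j
          by_cases hj : j = i
          · subst hj; simp [qv]
          · simp [qv, hj]
        rw [hi, ← mulVec_mulVec, reflMat_mulVec _ hv, reflMat_mulVec _ hv, zrefl_invol _ hv,
          one_mulVec]
      let r : (Matrix (Fin n) (Fin n) ℚ)ˣ := ⟨_, _, hsq, hsq⟩
      have hr : r ∈ Gu F u := Subgroup.subset_closure ⟨φ c, hadj, rfl⟩
      refine ⟨g * r, mul_mem hg hr, ?_⟩
      have hru : (r : Matrix (Fin n) (Fin n) ℚ).mulVec (qv u) = qv (φ c) := by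
        change (reflMat (qm F) (qv (u - φ c))).mulVec (qv u) = _
        rw [reflMat_mulVec _ hv, huw]
      rw [Units.val_mul, ← mulVec_mulVec, hru, ← h1, mulVec_mulVec, Units.mul_inv, one_mulVec]
end

section
/- Let n ≥ 7 be odd. Let A ∈ GL_n(ℤ) be the Levelt companion matrix of P(x) = xⁿ + a₁xⁿ⁻¹ + ⋯ + a_{n−1}x + 1 where a₁ = a_{n−1} = 3, a₂ = a_{n−2} = 5, and aᵢ = 6 for 3 ≤ i ≤ n−3 (so P(x) = (x+1)(x²+x+1)(x^{n−2}−1)/(x−1)), and let B ∈ GL_n(ℤ) be the Levelt companion matrix of Q(x) = xⁿ − xⁿ⁻¹ + xⁿ⁻² − ⋯ + x − 1 (coefficients bᵢ = (−1)^i). Set v := (a_{n−1}+b_{n−1}, …, a₁+b₁, 2)ᵗ. Let f ∈ M_n(ℚ) be symmetric with AᵗfA = f, BᵗfB = f, and vᵗfv = −2. Then for all 0 ≤ i, j ≤ n−1: (B^i v)ᵗ f (B^j v) equals −2 if i = j; −4 if |i−j| = 1; −8 if |i−j| = 2 or |i−j| = n−1; −11 if |i−j| = 3 or |i−j| = n−2;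 and −12 otherwise. (This is the normalized invariant quadratic form of the hyperbolic hypergeometric monodromy group of the family 𝒩₁(3,n,n).) -/
open Matrix

/-- The Levelt companion matrix of the monic polynomial
`xⁿ + c 1 * xⁿ⁻¹ + ⋯ + c (n-1) * x + c n`. -/
def levelt (n : ℕ) (c : ℕ → ℤ) : Matrix (Fin n) (Fin n) ℤ :=
  Matrix.of fun i j =>
    if (j : ℕ) = n - 1 then -c (n - (i : ℕ))
    else if (i : ℕ) = (j : ℕ) + 1 then 1 else 0

/-- The vector `v = (a_{n-1}+b_{n-1}, a_{n-2}+b_{n-2}, …, a₁+b₁, 2)ᵗ`. -/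
def vvec (n : ℕ) (a b : ℕ → ℤ) : Fin n → ℤ :=
  fun i => if (i : ℕ) = n - 1 then 2 else a (n - 1 - (i : ℕ)) + b (n - 1 - (i : ℕ))

/-- Coefficients of `P(x) = (x+1)(x²+x+1)(x^{n-2}-1)/(x-1)`:
`a₁ = a_{n-1} = 3`, `a₂ = a_{n-2} = 5`, `aᵢ = 6` for `3 ≤ i ≤ n-3`, constant term `1`. -/
def cP11 (n : ℕ) : ℕ → ℤ := fun k =>
  if k = n then 1
  else if k = 1 ∨ k = n - 1 then 3
  else if k = 2 ∨ k = n - 2 then 5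
  else 6

/-- Coefficients of `Q(x) = xⁿ - xⁿ⁻¹ + xⁿ⁻² - ⋯ + x - 1` (for odd `n`). -/
def cQalt : ℕ → ℤ := fun k => (-1) ^ k


theorem levelt_mulVec_zero (n : ℕ) (hn : 7 ≤ n) (c : ℕ → ℤ) (x : Fin n → ℚ) :
    ((qm (levelt n c)).mulVec x) ⟨0, by omega⟩ = - (c n : ℚ) * x ⟨n - 1, by omega⟩ := by
  simp only [Matrix.mulVec, dotProduct]
  rw [Finset.sum_eq_single (⟨n - 1, by omega⟩ : Fin n)]
  · simp [qm, levelt]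
  · intro b _ hb
    have hb' : (b : ℕ) ≠ n - 1 := fun h => hb (Fin.ext h)
    simp [qm, levelt, hb']
  · simp

theorem levelt_mulVec_succ (n : ℕ) (hn : 7 ≤ n) (c : ℕ → ℤ) (x : Fin n → ℚ) (i : ℕ)
    (hi : i + 1 < n) :
    ((qm (levelt n c)).mulVec x) ⟨i + 1, hi⟩ =
      x ⟨i, by omega⟩ - (c (n - (i + 1)) : ℚ) * x ⟨n - 1, by omega⟩ := by
  simp only [Matrix.mulVec, dotProduct]
  have hne : (⟨n - 1, by omega⟩ : Fin n) ≠ ⟨i, by omega⟩ := by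
    intro h
    have := congrArg Fin.val h
    simp at this
    omega
  rw [Finset.sum_eq_add (⟨n - 1, by omega⟩ : Fin n) ⟨i, by omega⟩ hne]
  · have : i ≠ n - 1 := by omega
    simp [qm, levelt, this]
    ring
  · intro b _ hb
    have hb' : (b : ℕ) ≠ n - 1 := fun h => hb.1 (Fin.ext h)
    have hb2 : i ≠ (b : ℕ) := fun h => hb.2 (Fin.ext h.symm)
    simp [qm, levelt, hb', hb2]
  · simp
  · simp

theorem cQ_flip (n i : ℕ) (hodd : Odd n) (hi : i ≤ n) :
    ((cQalt (n - i) : ℤ) : ℚ) = - (-1) ^ i := by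
  unfold cQalt
  push_cast
  have h : ((-1 : ℚ)) ^ (n - i) * (-1) ^ i = -1 := by
    rw [← pow_add, Nat.sub_add_cancel hi, hodd.neg_one_pow]
  rcases neg_one_pow_eq_or ℚ i with h1 | h1 <;> rw [h1] at h ⊢ <;> linarith

theorem g_shift (n : ℕ) (hn : 7 ≤ n) (hodd : Odd n) (x : Fin n → ℚ) (k : ℕ) :
    ∀ i (h : i + 1 + k < n),
    ((qm (levelt n cQalt) ^ k).mulVec x) ⟨i + 1 + k, h⟩ +
      ((qm (levelt n cQalt) ^ k).mulVec x) ⟨i + k, by omega⟩ =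
    x ⟨i + 1, by omega⟩ + x ⟨i, by omega⟩ := by
  induction k with
  | zero => intro i h; simp
  | succ k ih =>
    intro i h
    rw [← ih i (by omega), pow_succ', ← Matrix.mulVec_mulVec]
    have e1 := levelt_mulVec_succ n hn cQalt ((qm (levelt n cQalt) ^ k).mulVec x) (i + 1 + k)
      (by omega)
    have e2 := levelt_mulVec_succ n hn cQalt ((qm (levelt n cQalt) ^ k).mulVec x) (i + k)
      (by omega)
    rw [cQ_flip n _ hodd (by omega)] at e1 e2
    have p : ((-1 : ℚ)) ^ (i + 1 + k + 1) = - (-1) ^ (i + k + 1) := by ring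
    rw [p] at e1
    simp only [← add_assoc] at *
    rw [e1, e2]
    ring

theorem last_coord (n : ℕ) (hn : 7 ≤ n) (hodd : Odd n) (x : Fin n → ℚ) (k i : ℕ)
    (h : i + 1 + k = n - 1) :
    ((qm (levelt n cQalt) ^ (k + 1)).mulVec x) ⟨n - 1, by omega⟩ =
    x ⟨i + 1, by omega⟩ + x ⟨i, by omega⟩ := by
  rw [← g_shift n hn hodd x k i (by omega), pow_succ', ← Matrix.mulVec_mulVec]
  have e1 := levelt_mulVec_succ n hn cQalt ((qm (levelt n cQalt) ^ k).mulVec x) (i + k)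
      (by omega)
  rw [cQ_flip n _ hodd (by omega)] at e1
  have p : ((-1 : ℚ)) ^ (i + k + 1) = 1 := by
    have : Even (i + k + 1) := by
      obtain ⟨m, hm⟩ := hodd
      exact ⟨m, by omega⟩
    exact this.neg_one_pow
  rw [p] at e1
  have q : (⟨n - 1, by omega⟩ : Fin n) = ⟨i + k + 1, by omega⟩ := Fin.ext (by simp; omega)
  have q2 : (⟨i + 1 + k, by omega⟩ : Fin n) = ⟨i + k + 1, by omega⟩ := Fin.ext (by simp; omega)
  rw [q2]
  rw [q] at e1 ⊢
  rw [e1]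
  ring

/-- The value of the form at distance `k`. -/
def val11 (n k : ℕ) : ℚ :=
  if k = 0 then -2 else if k = 1 then -4 else if k = 2 ∨ k = n - 1 then -8
  else if k = 3 ∨ k = n - 2 then -11 else -12

theorem last_v (n : ℕ) (hn : 7 ≤ n) (hodd : Odd n) (k : ℕ) (hk : k ≤ n - 1) :
    ((qm (levelt n cQalt) ^ k).mulVec (qv (vvec n (cP11 n) cQalt))) ⟨n - 1, by omega⟩ =
      - val11 n k := by
  rcases k with _ | k
  · simp [qv, vvec, val11]
  · obtain ⟨i, hi⟩ : ∃ i, i + 1 + k = n - 1 := ⟨n - 1 - k - 1, by omega⟩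
    rw [last_coord n hn hodd _ k i hi]
    rcases k with _ | k
    · have h1 : i + 1 = n - 1 := by omega
      have h2 : i ≠ n - 1 := by omega
      have h3 : n - 1 - i = 1 := by omega
      have h4 : 1 ≠ n := by omega
      simp [qv, vvec, val11, h1, h2, h3, cP11, cQalt, h4]
      norm_num
    · have h1 : i + 1 ≠ n - 1 := by omega
      have h2 : i ≠ n - 1 := by omega
      have h3 : n - 1 - i = k + 2 := by omega
      have h4 : n - 1 - (i + 1) = k + 1 := by omega
      have h5 : cQalt (k + 1) = - cQalt (k + 2) := by unfold cQalt; ring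
      have h6 : cP11 n (k + 1) + cP11 n (k + 2) =
          if k + 2 = 2 ∨ k + 2 = n - 1 then 8 else if k + 2 = 3 ∨ k + 2 = n - 2 then 11
          else 12 := by
        unfold cP11
        split_ifs <;> first | rfl | (exfalso; omega)
      have h7 : (qv (vvec n (cP11 n) cQalt)) ⟨i + 1, by omega⟩ +
          (qv (vvec n (cP11 n) cQalt)) ⟨i, by omega⟩ =
          ((cP11 n (k + 1) + cP11 n (k + 2) : ℤ) : ℚ) := by
        simp only [qv, vvec, h1, h2, h3, h4, h5, if_false]
        push_cast
        ring
      rw [h7, h6]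
      unfold val11
      have z1 : k + 1 + 1 ≠ 0 := by omega
      have z2 : k + 1 + 1 ≠ 1 := by omega
      rw [if_neg z1, if_neg z2]
      split_ifs <;> norm_num

theorem form_inv (n : ℕ) (f M : Matrix (Fin n) (Fin n) ℚ) (h : Mᵀ * f * M = f)
    (x y : Fin n → ℚ) : (M.mulVec x) ⬝ᵥ f.mulVec (M.mulVec y) = x ⬝ᵥ f.mulVec y := by
  conv_rhs => rw [← h]
  rw [← Matrix.mulVec_mulVec, ← Matrix.mulVec_mulVec, Matrix.dotProduct_mulVec x,
    Matrix.vecMul_transpose]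

theorem form_inv_pow (n : ℕ) (f M : Matrix (Fin n) (Fin n) ℚ) (h : Mᵀ * f * M = f)
    (x y : Fin n → ℚ) (k : ℕ) :
    ((M ^ k).mulVec x) ⬝ᵥ f.mulVec ((M ^ k).mulVec y) = x ⬝ᵥ f.mulVec y := by
  induction k with
  | zero => simp
  | succ k ih =>
    rw [pow_succ', ← Matrix.mulVec_mulVec, ← Matrix.mulVec_mulVec, form_inv n f M h, ih]

theorem A_eq (n : ℕ) (hn : 7 ≤ n) (hodd : Odd n) (x : Fin n → ℚ) :
    (qm (levelt n (cP11 n))).mulVec x = (qm (levelt n cQalt)).mulVec x +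
      x ⟨n - 1, by omega⟩ •
        (qm (levelt n (cP11 n))).mulVec (qv (vvec n (cP11 n) cQalt)) := by
  funext ⟨j, hj⟩
  have hl : (qv (vvec n (cP11 n) cQalt)) ⟨n - 1, by omega⟩ = 2 := by simp [qv, vvec]
  simp only [Pi.add_apply, Pi.smul_apply, smul_eq_mul]
  rcases j with _ | j
  · rw [levelt_mulVec_zero n hn, levelt_mulVec_zero n hn, levelt_mulVec_zero n hn, hl]
    have h1 : cP11 n n = 1 := by simp [cP11]
    have h2 : ((cQalt n : ℤ) : ℚ) = -1 := by simp [cQalt, hodd.neg_one_pow]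
    rw [h1, h2]; push_cast; ring
  · rw [levelt_mulVec_succ n hn, levelt_mulVec_succ n hn, levelt_mulVec_succ n hn, hl]
    have h2 : j ≠ n - 1 := by omega
    have h3 : n - 1 - j = n - (j + 1) := by omega
    simp only [qv, vvec, h2, h3, if_false]
    push_cast
    ring

theorem form_v (n : ℕ) (hn : 7 ≤ n) (hodd : Odd n)
    (f : Matrix (Fin n) (Fin n) ℚ)
    (hfA : (qm (levelt n (cP11 n)))ᵀ * f * qm (levelt n (cP11 n)) = f)
    (hfB : (qm (levelt n cQalt))ᵀ * f * qm (levelt n cQalt) = f)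
    (hv : qv (vvec n (cP11 n) cQalt) ⬝ᵥ f.mulVec (qv (vvec n (cP11 n) cQalt)) = -2)
    (x : Fin n → ℚ) :
    x ⬝ᵥ f.mulVec (qv (vvec n (cP11 n) cQalt)) = - x ⟨n - 1, by omega⟩ := by
  have hl : (qv (vvec n (cP11 n) cQalt)) ⟨n - 1, by omega⟩ = 2 := by simp [qv, vvec]
  have hx := A_eq n hn hodd x
  have hvv := A_eq n hn hodd (qv (vvec n (cP11 n) cQalt))
  rw [hl] at hvv
  have IA := form_inv n f _ hfA
  have IB := form_inv n f _ hfB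
  generalize qv (vvec n (cP11 n) cQalt) = v at *
  generalize qm (levelt n (cP11 n)) = A at *
  generalize qm (levelt n cQalt) = B at *
  have hB : B.mulVec v = - A.mulVec v := by
    rw [two_smul] at hvv
    rw [eq_neg_iff_add_eq_zero]
    have : A.mulVec v + 0 = A.mulVec v + (B.mulVec v + A.mulVec v) := by
      rw [add_zero]; nth_rewrite 1 [hvv]; abel
    exact (add_left_cancel this).symm
  have h1 := IA x v
  have h2 := IB x v
  have h3 := IA v v
  rw [hx, add_dotProduct, smul_dotProduct, h3, hv] at h1
  rw [hB, Matrix.mulVec_neg, dotProduct_neg] at h2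
  simp only [smul_eq_mul] at h1
  linarith

theorem form_val (n : ℕ) (hn : 7 ≤ n) (hodd : Odd n)
    (f : Matrix (Fin n) (Fin n) ℚ) (hsymm : f.IsSymm)
    (hfA : (qm (levelt n (cP11 n)))ᵀ * f * qm (levelt n (cP11 n)) = f)
    (hfB : (qm (levelt n cQalt))ᵀ * f * qm (levelt n cQalt) = f)
    (hv : qv (vvec n (cP11 n) cQalt) ⬝ᵥ f.mulVec (qv (vvec n (cP11 n) cQalt)) = -2)
    (i j : ℕ) (hi : i ≤ n - 1) (hj : j ≤ n - 1) :
    ((qm (levelt n cQalt) ^ i).mulVec (qv (vvec n (cP11 n) cQalt))) ⬝ᵥ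
          f.mulVec ((qm (levelt n cQalt) ^ j).mulVec (qv (vvec n (cP11 n) cQalt))) =
    val11 n ((i : ℤ) - (j : ℤ)).natAbs := by
  wlog h : j ≤ i generalizing i j
  · have := this j i hj hi (by omega)
    rw [show ((i : ℤ) - (j : ℤ)).natAbs = ((j : ℤ) - (i : ℤ)).natAbs by omega, ← this,
      Matrix.dotProduct_mulVec, ← Matrix.mulVec_transpose, hsymm.eq, dotProduct_comm]
  · obtain ⟨k, rfl⟩ := Nat.exists_eq_add_of_le h
    rw [pow_add, ← Matrix.mulVec_mulVec, form_inv_pow n f _ hfB,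
      form_v n hn hodd f hfA hfB hv, last_v n hn hodd k (by omega)]
    rw [show (((j + k : ℕ) : ℤ) - (j : ℤ)).natAbs = k by omega, neg_neg]

theorem stmt11 (n : ℕ) (hn : 7 ≤ n) (hodd : Odd n)
    (f : Matrix (Fin n) (Fin n) ℚ) (hsymm : f.IsSymm)
    (hfA : (qm (levelt n (cP11 n)))ᵀ * f * qm (levelt n (cP11 n)) = f)
    (hfB : (qm (levelt n cQalt))ᵀ * f * qm (levelt n cQalt) = f)
    (hv : qv (vvec n (cP11 n) cQalt) ⬝ᵥ f.mulVec (qv (vvec n (cP11 n) cQalt)) = -2) :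
    ∀ i j : ℕ, i ≤ n - 1 → j ≤ n - 1 →
      ((i = j →
        ((qm (levelt n cQalt) ^ i).mulVec (qv (vvec n (cP11 n) cQalt))) ⬝ᵥ
          f.mulVec ((qm (levelt n cQalt) ^ j).mulVec (qv (vvec n (cP11 n) cQalt))) = -2) ∧
      (((i : ℤ) - (j : ℤ)).natAbs = 1 →
        ((qm (levelt n cQalt) ^ i).mulVec (qv (vvec n (cP11 n) cQalt))) ⬝ᵥ
          f.mulVec ((qm (levelt n cQalt) ^ j).mulVec (qv (vvec n (cP11 n) cQalt))) = -4) ∧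
      (((i : ℤ) - (j : ℤ)).natAbs = 2 ∨ ((i : ℤ) - (j : ℤ)).natAbs = n - 1 →
        ((qm (levelt n cQalt) ^ i).mulVec (qv (vvec n (cP11 n) cQalt))) ⬝ᵥ
          f.mulVec ((qm (levelt n cQalt) ^ j).mulVec (qv (vvec n (cP11 n) cQalt))) = -8) ∧
      (((i : ℤ) - (j : ℤ)).natAbs = 3 ∨ ((i : ℤ) - (j : ℤ)).natAbs = n - 2 →
        ((qm (levelt n cQalt) ^ i).mulVec (qv (vvec n (cP11 n) cQalt))) ⬝ᵥ
          f.mulVec ((qm (levelt n cQalt) ^ j).mulVec (qv (vvec n (cP11 n) cQalt))) = -11) ∧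
      (((i : ℤ) - (j : ℤ)).natAbs ≠ 0 ∧ ((i : ℤ) - (j : ℤ)).natAbs ≠ 1 ∧
        ((i : ℤ) - (j : ℤ)).natAbs ≠ 2 ∧ ((i : ℤ) - (j : ℤ)).natAbs ≠ 3 ∧
        ((i : ℤ) - (j : ℤ)).natAbs ≠ n - 1 ∧ ((i : ℤ) - (j : ℤ)).natAbs ≠ n - 2 →
        ((qm (levelt n cQalt) ^ i).mulVec (qv (vvec n (cP11 n) cQalt))) ⬝ᵥ
          f.mulVec ((qm (levelt n cQalt) ^ j).mulVec (qv (vvec n (cP11 n) cQalt))) = -12)) := by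
  intro i j hi hj
  rw [form_val n hn hodd f hsymm hfA hfB hv i j hi hj]
  generalize hd : ((i : ℤ) - (j : ℤ)).natAbs = d
  unfold val11
  refine ⟨fun h => ?_, fun h => ?_, fun h => ?_, fun h => ?_, fun h => ?_⟩ <;>
    split_ifs <;> first | rfl | (exfalso; omega)
end
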